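/- Let (T¹,T²) ∈ ℝ² with (T¹,T²) ≠ (0,0), and consider on the half-plane U = {(x¹,x²) ∈ ℝ² : x¹ > 0} the Type B connection with Christoffel symbols Γ_{11}¹ = −1/x¹, Γ_{12}¹ = T¹/x¹, Γ_{12}² = (−1 + T²)/x¹, Γ_{21}¹ = −T¹/x¹, Γ_{21}² = (−1 − T²)/x¹, Γ_{22}¹ = −1/x¹, and all other Γ_{ij}^k = 0 (the Lorentzian hyperbolic plane N₃³ perturbed by nonzero torsion T). Then a smooth vector field X on U is an affine Killing vector field for this connection if and only if X lies in the ℝ-linear span of the two vector fields (x¹, x²) and (0,1). -/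

import Mathlib

open Real

/-- The partial derivative `∂f/∂x^i` of a function on `ℝ²` (points are `Fin 2 → ℝ`). -/
noncomputable def pd (f : (Fin 2 → ℝ) → ℝ) (i : Fin 2) (p : Fin 2 → ℝ) : ℝ :=
  fderiv ℝ f p (Pi.single i 1)

/-- The affine Killing operator
`K^Γ_{ij}^k(v) = ∂_i∂_j v^k + v^l ∂_l Γ_{ij}^k − Γ_{ij}^l ∂_l v^k + Γ_{il}^k ∂_j v^l + Γ_{lj}^k ∂_i v^l`
(summation over `l`). -/
noncomputable def killingOp (Γ : Fin 2 → Fin 2 → Fin 2 → (Fin 2 → ℝ) → ℝ)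
    (v : Fin 2 → (Fin 2 → ℝ) → ℝ) (i j k : Fin 2) (p : Fin 2 → ℝ) : ℝ :=
  pd (fun q => pd (v k) j q) i p
    + (∑ l : Fin 2, v l p * pd (Γ i j k) l p)
    - (∑ l : Fin 2, Γ i j l p * pd (v k) l p)
    + (∑ l : Fin 2, Γ i l k p * pd (v l) j p)
    + (∑ l : Fin 2, Γ l j k p * pd (v l) i p)

/-- `v` is an affine Killing vector field for the connection `Γ` on `U`:
all eight affine Killing equations hold on `U`. -/
def IsAffineKilling (U : Set (Fin 2 → ℝ))
    (Γ : Fin 2 → Fin 2 → Fin 2 → (Fin 2 → ℝ) → ℝ)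
    (v : Fin 2 → (Fin 2 → ℝ) → ℝ) : Prop :=
  ∀ i j k : Fin 2, ∀ p ∈ U, killingOp Γ v i j k p = 0

section PartialDerivatives

variable {f g : (Fin 2 → ℝ) → ℝ} {U : Set (Fin 2 → ℝ)} {p : Fin 2 → ℝ}

lemma ContDiffOn.pd (hU : IsOpen U) (hf : ContDiffOn ℝ (⊤ : ℕ∞) f U) (i : Fin 2) :
    ContDiffOn ℝ (⊤ : ℕ∞) (pd f i) U :=
  (hf.fderiv_of_isOpen hU (by simp)).clm_apply contDiffOn_const

lemma ContDiffOn.differentiableAt_of_isOpen (hU : IsOpen U)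
    (hf : ContDiffOn ℝ (⊤ : ℕ∞) f U) (hp : p ∈ U) : DifferentiableAt ℝ f p :=
  (hf.contDiffAt (hU.mem_nhds hp)).differentiableAt (by simp)

lemma pd_comm (hU : IsOpen U) (hf : ContDiffOn ℝ (⊤ : ℕ∞) f U) (hp : p ∈ U) (i j : Fin 2) :
    pd (pd f j) i p = pd (pd f i) j p := by
  have hd : DifferentiableAt ℝ (fderiv ℝ f) p :=
    ((hf.fderiv_of_isOpen (m := 1) hU (by norm_cast)).contDiffAt
      (hU.mem_nhds hp)).differentiableAt (by simp)
  have key (a b : Fin 2) :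
      pd (pd f a) b p = fderiv ℝ (fderiv ℝ f) p (Pi.single b 1) (Pi.single a 1) := by
    change fderiv ℝ (fun q => fderiv ℝ f q (Pi.single a 1)) p (Pi.single b 1) = _
    rw [fderiv_clm_apply hd (differentiableAt_const _)]
    simp
  rw [key, key]
  exact ((hf.contDiffAt (hU.mem_nhds hp)).isSymmSndFDerivAt (by simp; norm_cast)).eq _ _

lemma pd_congr (hU : IsOpen U) (h : Set.EqOn f g U) (hp : p ∈ U) (i : Fin 2) :
    pd f i p = pd g i p := by
  rw [pd, pd, (h.eventuallyEq_of_mem (hU.mem_nhds hp)).fderiv_eq]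

@[simp] lemma pd_const (c : ℝ) (i : Fin 2) : pd (fun _ => c) i p = 0 := by
  simp [pd]

lemma pd_const_mul_coord (c : ℝ) (k i : Fin 2) :
    pd (fun q => c * q k) i p = c * (Pi.single i 1 : Fin 2 → ℝ) k := by
  have h : HasFDerivAt (fun q : Fin 2 → ℝ => c * q k)
      (c • ContinuousLinearMap.proj (R := ℝ) (φ := fun _ : Fin 2 => ℝ) k) p :=
    (hasFDerivAt_apply k p).const_mul c
  rw [pd, h.fderiv]
  simp

lemma pd_add_const (c : ℝ) (i : Fin 2) : pd (fun q => f q + c) i p = pd f i p := by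
  simp [pd]

lemma pd_sub (hf : DifferentiableAt ℝ f p) (hg : DifferentiableAt ℝ g p) (i : Fin 2) :
    pd (fun q => f q - g q) i p = pd f i p - pd g i p := by
  simp [pd, fderiv_fun_sub hf hg]

lemma pd_coord_mul (hf : DifferentiableAt ℝ f p) (k i : Fin 2) :
    pd (fun q => q k * f q) i p = (Pi.single i 1 : Fin 2 → ℝ) k * f p + p k * pd f i p := by
  have h := (hasFDerivAt_apply (𝕜 := ℝ) k p).mul hf.hasFDerivAt
  rw [pd, show (fun q => q k * f q) = (fun q => q k) * f from rfl, h.fderiv]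
  simp [pd]
  ring

lemma pd_const_div_coord (c : ℝ) {k : Fin 2} (hk : p k ≠ 0) (i : Fin 2) :
    pd (fun q => c / q k) i p = -(c * (Pi.single i 1 : Fin 2 → ℝ) k) / p k ^ 2 := by
  have h := ((hasDerivAt_inv hk).comp_hasFDerivAt p (hasFDerivAt_apply (𝕜 := ℝ) k p)).const_mul c
  rw [pd, show (fun q : Fin 2 → ℝ => c / q k) = fun q => c * (Inv.inv ∘ fun r => r k) q from
    funext fun _ => div_eq_mul_inv _ _, h.fderiv]
  simp
  ring

lemma exists_eq_const_of_pd_eq_zero (hU : IsOpen U) (hc : IsPreconnected U)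
    (hf : DifferentiableOn ℝ f U) (h : ∀ p ∈ U, ∀ i, pd f i p = 0) :
    ∃ c, ∀ p ∈ U, f p = c := by
  refine hU.exists_is_const_of_fderiv_eq_zero hc hf fun p hp => ?_
  ext x
  have hx : x = x 0 • Pi.single 0 1 + x 1 • Pi.single 1 1 := by
    ext i
    fin_cases i <;> simp
  have h0 := h p hp 0
  have h1 := h p hp 1
  rw [pd] at h0 h1
  rw [hx, map_add, map_smul, map_smul, h0, h1]
  simp

end PartialDerivatives

lemma isOpen_halfPlane : IsOpen {p : Fin 2 → ℝ | 0 < p 0} :=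
  isOpen_lt continuous_const (continuous_apply 0)

lemma isPreconnected_halfPlane : IsPreconnected {p : Fin 2 → ℝ | 0 < p 0} :=
  (convex_halfSpace_gt (LinearMap.proj (R := ℝ) (φ := fun _ : Fin 2 => ℝ) 0).isLinear
    0).isPreconnected

lemma killingOp_typeB (A : Fin 2 → Fin 2 → Fin 2 → ℝ) (v : Fin 2 → (Fin 2 → ℝ) → ℝ)
    (i j k : Fin 2) {p : Fin 2 → ℝ} (hp : p 0 ≠ 0) :
    killingOp (fun i j k p => A i j k / p 0) v i j k p =
      pd (pd (v k) j) i p - v 0 p * A i j k / p 0 ^ 2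
        - (A i j 0 * pd (v k) 0 p + A i j 1 * pd (v k) 1 p) / p 0
        + (A i 0 k * pd (v 0) j p + A i 1 k * pd (v 1) j p) / p 0
        + (A 0 j k * pd (v 0) i p + A 1 j k * pd (v 1) i p) / p 0 := by
  simp only [killingOp, Fin.sum_univ_two, pd_const_div_coord _ hp]
  simp
  ring

theorem stmt18 (T1 T2 : ℝ) (hT : (T1, T2) ≠ (0, 0))
    (v : Fin 2 → (Fin 2 → ℝ) → ℝ)
    (hv : ∀ i : Fin 2, ContDiffOn ℝ (⊤ : ℕ∞) (v i) {p : Fin 2 → ℝ | 0 < p 0}) :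
    IsAffineKilling {p : Fin 2 → ℝ | 0 < p 0}
      (fun i j k => fun p : Fin 2 → ℝ =>
        ![![![(-1 : ℝ), 0], ![T1, -1 + T2]],
          ![![-T1, -1 - T2], ![-1, 0]]] i j k / p 0) v
    ↔ ∃ a b : ℝ, ∀ p ∈ {p : Fin 2 → ℝ | 0 < p 0},
        v 0 p = a * p 0 ∧ v 1 p = a * p 1 + b := by
  set U : Set (Fin 2 → ℝ) := {p | 0 < p 0}
  have hU : IsOpen U := isOpen_halfPlane
  have hd {f : (Fin 2 → ℝ) → ℝ} (hf : ContDiffOn ℝ (⊤ : ℕ∞) f U) {p : Fin 2 → ℝ} (hp : p ∈ U) :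
      DifferentiableAt ℝ f p := hf.differentiableAt_of_isOpen hU hp
  have hpd (k i : Fin 2) := (hv k).pd hU i
  constructor
  · intro hK
    have hK' (i j k : Fin 2) (p : Fin 2 → ℝ) (hp : p ∈ U) :=
      (killingOp_typeB _ v i j k (ne_of_gt hp)).symm.trans (hK i j k p hp)
    have hWx : ∀ p ∈ U, p 0 * pd (pd (v 1) 0) 0 p = pd (v 1) 0 p := by
      intro p hp
      have h0 : p 0 ≠ 0 := ne_of_gt hp
      have h := hK' 0 0 1 p hp
      simp at h
      field_simp at h
      linarith
    have hux : ∀ p ∈ U, p 0 * (p 0 * pd (pd (v 0) 0) 0 p) = p 0 * pd (v 0) 0 p - v 0 p := by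
      intro p hp
      have h0 : p 0 ≠ 0 := ne_of_gt hp
      have h := hK' 0 0 0 p hp
      simp at h
      field_simp at h
      linarith
    have hWy : ∀ p ∈ U, p 0 * (p 0 * pd (pd (v 1) 0) 1 p) = p 0 * pd (v 0) 0 p - v 0 p := by
      intro p hp
      have h0 : p 0 ≠ 0 := ne_of_gt hp
      have h := hK' 0 1 1 p hp
      have h' := hK' 1 0 1 p hp
      rw [pd_comm hU (hv 1) hp 0 1] at h
      simp at h h'
      field_simp at h h'
      linarith
    -- Equality of the mixed second derivatives of `∂₁v²` forces `v¹` to be homogeneous in `x¹`.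
    have hhom : ∀ p ∈ U, p 0 * pd (v 0) 0 p = v 0 p := by
      intro p hp
      have h0 : p 0 ≠ 0 := ne_of_gt hp
      have e1 := pd_congr hU hWx hp 1
      have e2 := pd_congr hU hWy hp 0
      have hW := (hpd 1 0).pd hU
      rw [pd_coord_mul (hd (hW 0) hp)] at e1
      rw [pd_coord_mul (f := fun q => q 0 * pd (pd (v 1) 0) 1 q)
          ((differentiableAt_apply 0 p).mul (hd (hW 1) hp)),
        pd_coord_mul (hd (hW 1) hp),
        pd_sub (f := fun q => q 0 * pd (v 0) 0 q)
          ((differentiableAt_apply 0 p).mul (hd (hpd 0 0) hp)) (hd (hv 0) hp),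
        pd_coord_mul (hd (hpd 0 0) hp), pd_comm hU (hpd 1 0) hp 0 1] at e2
      simp at e1 e2
      have h1 := hWy p hp
      have h2 := hux p hp
      linear_combination (p 0 / 2) * e2 - (p 0 ^ 2 / 2) * e1 - (3 / 2) * h1 + (1 / 2) * h2
    have huy : ∀ p ∈ U, pd (v 0) 1 p = pd (v 1) 0 p := by
      intro p hp
      have h0 : p 0 ≠ 0 := ne_of_gt hp
      have e := pd_congr hU hhom hp 1
      rw [pd_coord_mul (hd (hpd 0 0) hp)] at e
      have h := hK' 0 1 0 p hp
      have h' := hK' 1 0 0 p hp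
      rw [pd_comm hU (hv 0) hp 0 1] at h
      simp at e h h'
      field_simp at h h'
      apply mul_left_cancel₀ h0
      linear_combination (h + h') / 2 - p 0 * e
    have hwy : ∀ p ∈ U, p 0 * pd (v 1) 1 p = v 0 p := by
      intro p hp
      have h0 : p 0 ≠ 0 := ne_of_gt hp
      have e := pd_congr hU huy hp 1
      have h1 := hWy p hp
      have h2 := hhom p hp
      have hz : pd (pd (v 1) 0) 1 p = 0 := by
        rw [h2, sub_self] at h1
        simpa [h0] using h1
      have h := hK' 1 1 0 p hp
      rw [e, hz] at h
      simp at h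
      field_simp at h
      linarith
    have hwx : ∀ p ∈ U, pd (v 1) 0 p = 0 := by
      intro p hp
      have h0 : p 0 ≠ 0 := ne_of_gt hp
      have h1 := hhom p hp
      have h2 := hwy p hp
      have h3 := huy p hp
      have a1 := hK' 0 1 0 p hp
      have a2 := hK' 1 0 0 p hp
      have a3 := hK' 0 1 1 p hp
      have a4 := hK' 1 0 1 p hp
      rw [pd_comm hU (hv _) hp 0 1] at a1 a3
      simp at a1 a2 a3 a4
      field_simp at a1 a2 a3 a4
      have t2 : T2 * pd (v 1) 0 p = 0 := by
        apply mul_left_cancel₀ h0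
        linear_combination -(a1 - a2) / 2 + T1 * h2 - p 0 * T2 * h3
      have t1 : T1 * pd (v 1) 0 p = 0 := by
        apply mul_left_cancel₀ h0
        linear_combination -(a3 - a4) / 2 + T2 * h1
      by_contra hne
      exact hT (Prod.ext ((mul_eq_zero.mp t1).resolve_right hne)
        ((mul_eq_zero.mp t2).resolve_right hne))
    obtain ⟨a, ha⟩ := exists_eq_const_of_pd_eq_zero hU isPreconnected_halfPlane
      (fun p hp => (hd (hpd 1 1) hp).differentiableWithinAt) (by
        intro p hp i
        have h0 : p 0 ≠ 0 := ne_of_gt hp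
        have e := pd_congr hU hwy hp i
        rw [pd_coord_mul (hd (hpd 1 1) hp)] at e
        have h1 := hhom p hp
        have h2 := hwy p hp
        have h3 := (huy p hp).trans (hwx p hp)
        apply mul_left_cancel₀ h0
        fin_cases i
        · apply mul_left_cancel₀ h0
          simp only [Fin.zero_eta, Pi.single_eq_same, one_mul] at e ⊢
          linear_combination p 0 * e + h1 - h2
        · simp [h3] at e ⊢
          simpa [h0] using e)
    obtain ⟨b, hb⟩ := exists_eq_const_of_pd_eq_zero (f := fun p => v 1 p - a * p 1) hU
      isPreconnected_halfPlane
      (fun p hp => ((hd (hv 1) hp).sub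
        ((differentiableAt_apply 1 p).const_mul a)).differentiableWithinAt) (by
        intro p hp i
        rw [pd_sub (hd (hv 1) hp) ((differentiableAt_apply 1 p).const_mul a), pd_const_mul_coord]
        fin_cases i
        · simp [hwx p hp]
        · simp [ha p hp])
    refine ⟨a, b, fun p hp => ⟨?_, ?_⟩⟩
    · rw [← hwy p hp, ha p hp, mul_comm]
    · linarith [hb p hp]
  · rintro ⟨a, b, hab⟩ i j k p hp
    have h0 : p 0 ≠ 0 := ne_of_gt hp
    have d0 : ∀ q ∈ U, ∀ i, pd (v 0) i q = a * (Pi.single i 1 : Fin 2 → ℝ) 0 := fun q hq i => by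
      rw [pd_congr hU (fun r hr => (hab r hr).1) hq, pd_const_mul_coord]
    have d1 : ∀ q ∈ U, ∀ i, pd (v 1) i q = a * (Pi.single i 1 : Fin 2 → ℝ) 1 := fun q hq i => by
      rw [pd_congr hU (fun r hr => (hab r hr).2) hq, pd_add_const, pd_const_mul_coord]
    have dd : pd (pd (v k) j) i p = 0 := by
      fin_cases k
      · exact (pd_congr hU (fun q hq => d0 q hq j) hp i).trans (pd_const _ _)
      · exact (pd_congr hU (fun q hq => d1 q hq j) hp i).trans (pd_const _ _)
    refine (killingOp_typeB _ v i j k h0).trans ?_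
    rw [dd, (hab p hp).1]
    fin_cases k <;> fin_cases i <;> fin_cases j <;> simp [d0 p hp, d1 p hp] <;> field_simp <;> ring
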